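/- (Least Action Principle) Fix a realization of the instruction stacks and an initial configuration η on ℤ/nℤ. If α and α' are two legal toppling sequences for η and α stabilizes η, then h_{α'}(x) ≤ h_α(x) for every site x, i.e., every toppling performed in α' is also needed in α. -/

import Mathlib

open MeasureTheory ProbabilityTheory

namespace ARW

/-- The state of a site: either a number of active particles (possibly zero),
or a single sleepy particle. -/
inductive SiteState where
  | active : ℕ → SiteState
  | sleepy : SiteState
  deriving DecidableEq

/-- A Diaconis–Fulton instruction: move an active particle to the left or right
neighbour, try to put the particle at the site to sleep, or do nothing. -/
inductive Instr where
  | left : Instr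
  | right : Instr
  | sleep : Instr
  | null : Instr
  deriving DecidableEq

instance : MeasurableSpace Instr := ⊤

/-- A site holds at least one active particle. -/
def SiteState.isActive : SiteState → Prop
  | .active k => 0 < k
  | .sleepy => False

/-- Total number of particles at a site. -/
def SiteState.particleCount : SiteState → ℕ
  | .active k => k
  | .sleepy => 1

/-- Number of active particles at a site. -/
def SiteState.activeCount : SiteState → ℕ
  | .active k => k
  | .sleepy => 0

/-- Add one active particle to a site; a sleepy particle is woken up. -/
def addParticle : SiteState → SiteState
  | .active k => .active (k + 1)
  | .sleepy => .active 2

variable {V : Type} [AddGroup V] [One V] [DecidableEq V]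

/-- Move one active particle from `x` to `y` (no effect if `x` has no active particle). -/
def moveFrom (x y : V) (η : V → SiteState) : V → SiteState :=
  match η x with
  | .active (k + 1) =>
      let η' := Function.update η x (.active k)
      Function.update η' y (addParticle (η' y))
  | _ => η

/-- Apply one instruction at site `x`. -/
def applyInstr (i : Instr) (x : V) (η : V → SiteState) : V → SiteState :=
  match i with
  | .left => moveFrom x (x - 1) η
  | .right => moveFrom x (x + 1) η
  | .sleep =>
      match η x with
      | .active 1 => Function.update η x .sleepy
      | _ => η
  | .null => η

/-- One toppling at site `x`: use the first unused instruction from the stack at `x`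
and record its use. The second component counts used instructions per site. -/
def toppleStep (I : V → ℕ → Instr) (s : (V → SiteState) × (V → ℕ)) (x : V) :
    (V → SiteState) × (V → ℕ) :=
  (applyInstr (I x (s.2 x)) x s.1, Function.update s.2 x (s.2 x + 1))

/-- A sequence of topplings is legal from a given state: every toppled site holds
an active particle at the moment it is toppled. -/
def LegalFrom (I : V → ℕ → Instr) : (V → SiteState) × (V → ℕ) → List V → Prop
  | _, [] => True
  | s, x :: rest => (s.1 x).isActive ∧ LegalFrom I (toppleStep I s x) rest

/-- `α` is a legal toppling sequence for the initial configuration `η`. -/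
def IsLegal (I : V → ℕ → Instr) (η : V → SiteState) (α : List V) : Prop :=
  LegalFrom I (η, fun _ => 0) α

/-- The configuration obtained from `η` by toppling the sequence `α`. -/
def Phi (I : V → ℕ → Instr) (α : List V) (η : V → SiteState) : V → SiteState :=
  (α.foldl (toppleStep I) (η, fun _ => 0)).1

/-- The odometer of a toppling sequence: the number of topplings at each site. -/
def odometer (α : List V) (x : V) : ℕ := α.count x

/-- A configuration is stable if no site holds an active particle. -/
def IsStable (η : V → SiteState) : Prop := ∀ x, ¬ (η x).isActive

/-- `α` is a legal toppling sequence stabilizing `η`. -/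
def Stabilizes (I : V → ℕ → Instr) (η : V → SiteState) (α : List V) : Prop :=
  IsLegal I η α ∧ IsStable (Phi I α η)

/-- `α` is a legal toppling sequence using only sites of `D` after which no site of `D`
holds an active particle (particles outside `D` are frozen). -/
def StabilizesIn (I : V → ℕ → Instr) (η : V → SiteState) (D : Set V) (α : List V) : Prop :=
  (∀ x ∈ α, x ∈ D) ∧ IsLegal I η α ∧ ∀ x ∈ D, ¬ ((Phi I α η) x).isActive


theorem SiteState.isActive.exists_eq {s : SiteState} (h : s.isActive) :
    ∃ k, s = .active (k + 1) := by
  cases s with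
  | active k => exact ⟨k - 1, by simp only [SiteState.isActive] at h; congr 1; omega⟩
  | sleepy => exact h.elim

theorem isActive_addParticle (s : SiteState) : (addParticle s).isActive := by
  cases s <;> simp [addParticle, SiteState.isActive]

theorem moveFrom_of_not_isActive {V : Type} [DecidableEq V] {x y : V} {η : V → SiteState}
    (hx : ¬ (η x).isActive) : moveFrom x y η = η := by
  unfold moveFrom
  cases h : η x with
  | active k => cases k <;> simp_all [SiteState.isActive]
  | sleepy => rfl

theorem moveFrom_apply {V : Type} [DecidableEq V] {x y : V} {η : V → SiteState} {k : ℕ}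
    (hx : η x = .active (k + 1)) (z : V) :
    moveFrom x y η z = if z = y then addParticle (if y = x then .active k else η y)
      else if z = x then .active k else η z := by
  simp [moveFrom, hx, Function.update_apply]

theorem isActive_moveFrom {V : Type} [DecidableEq V] {x y z : V} {η : V → SiteState}
    (hzx : z ≠ x) (hz : (η z).isActive) : (moveFrom x y η z).isActive := by
  by_cases hx : (η x).isActive
  · obtain ⟨k, hk⟩ := hx.exists_eq
    rw [moveFrom_apply hk, if_neg hzx]
    split_ifs
    exacts [isActive_addParticle _, isActive_addParticle _, hz]
  · rwa [moveFrom_of_not_isActive hx]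

theorem applyInstr_sleep_apply {V : Type} [AddGroup V] [One V] [DecidableEq V] (x z : V)
    (η : V → SiteState) :
    applyInstr .sleep x η z = if z = x ∧ η x = .active 1 then .sleepy else η z := by
  by_cases h : η x = .active 1
  · simp [applyInstr, h, Function.update_apply]
  · have : applyInstr .sleep x η = η := by simp only [applyInstr]
    simp [this, h]

theorem isActive_applyInstr {V : Type} [AddGroup V] [One V] [DecidableEq V] {x z : V}
    {η : V → SiteState} (i : Instr) (hzx : z ≠ x) (hz : (η z).isActive) :
    (applyInstr i x η z).isActive := by
  cases i with
  | left => exact isActive_moveFrom hzx hz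
  | right => exact isActive_moveFrom hzx hz
  | sleep => simpa [applyInstr_sleep_apply, hzx] using hz
  | null => exact hz

theorem moveFrom_comm {V : Type} [DecidableEq V] {x y : V} (a b : V) {η : V → SiteState}
    (hxy : x ≠ y) (hx : (η x).isActive) (hy : (η y).isActive) :
    moveFrom x a (moveFrom y b η) = moveFrom y b (moveFrom x a η) := by
  obtain ⟨k, hk⟩ := hx.exists_eq
  obtain ⟨l, hl⟩ := hy.exists_eq
  obtain ⟨k', hk'⟩ := (isActive_moveFrom (y := b) hxy hx).exists_eq
  obtain ⟨l', hl'⟩ := (isActive_moveFrom (y := a) hxy.symm hy).exists_eq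
  funext z
  rw [moveFrom_apply hk', moveFrom_apply hl']
  simp only [moveFrom_apply hk, moveFrom_apply hl] at hk' hl' ⊢
  grind [addParticle]

theorem applyInstr_sleep_moveFrom_comm {V : Type} [AddGroup V] [One V] [DecidableEq V] {x y : V}
    (b : V) {η : V → SiteState}
    (hxy : x ≠ y) (hx : (η x).isActive) (hy : (η y).isActive) :
    applyInstr .sleep x (moveFrom y b η) = moveFrom y b (applyInstr .sleep x η) := by
  obtain ⟨k, hk⟩ := hx.exists_eq
  obtain ⟨l, hl⟩ := hy.exists_eq
  have hl' : applyInstr .sleep x η y = .active (l + 1) := by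
    simp [applyInstr_sleep_apply, hxy.symm, hl]
  funext z
  rw [moveFrom_apply hl']
  simp only [applyInstr_sleep_apply, moveFrom_apply hl]
  grind [addParticle]

theorem applyInstr_sleep_comm {V : Type} [AddGroup V] [One V] [DecidableEq V] {x y : V}
    {η : V → SiteState} (hxy : x ≠ y) :
    applyInstr .sleep x (applyInstr .sleep y η) = applyInstr .sleep y (applyInstr .sleep x η) := by
  funext z
  simp only [applyInstr_sleep_apply]
  grind

/-- Instructions at distinct active sites commute. -/
theorem applyInstr_comm {V : Type} [AddGroup V] [One V] [DecidableEq V] {x y : V} (i j : Instr)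
    {η : V → SiteState} (hxy : x ≠ y) (hx : (η x).isActive) (hy : (η y).isActive) :
    applyInstr i x (applyInstr j y η) = applyInstr j y (applyInstr i x η) := by
  cases i <;> cases j <;>
    first
    | rfl
    | exact moveFrom_comm _ _ hxy hx hy
    | exact applyInstr_sleep_moveFrom_comm _ hxy hx hy
    | exact (applyInstr_sleep_moveFrom_comm _ hxy.symm hy hx).symm
    | exact applyInstr_sleep_comm hxy

/-- The local abelian property: topplings at distinct active sites commute. -/
theorem toppleStep_comm {V : Type} [AddGroup V] [One V] [DecidableEq V] (I : V → ℕ → Instr)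
    {s : (V → SiteState) × (V → ℕ)} {x y : V}
    (hxy : x ≠ y) (hx : (s.1 x).isActive) (hy : (s.1 y).isActive) :
    toppleStep I (toppleStep I s x) y = toppleStep I (toppleStep I s y) x := by
  simp only [toppleStep, Function.update_of_ne hxy, Function.update_of_ne hxy.symm]
  rw [applyInstr_comm _ _ hxy hx hy, Function.update_comm hxy]

/-- In a legal stabilizing sequence, the first toppling of an initially active site can be
moved to the front. -/
theorem LegalFrom.erase {V : Type} [AddGroup V] [One V] [DecidableEq V] {I : V → ℕ → Instr}
    {α : List V} {s : (V → SiteState) × (V → ℕ)} {y : V} (hα : LegalFrom I s α)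
    (hs : IsStable (α.foldl (toppleStep I) s).1) (hy : (s.1 y).isActive) :
    y ∈ α ∧ LegalFrom I (toppleStep I s y) (α.erase y) ∧
      (α.erase y).foldl (toppleStep I) (toppleStep I s y) = α.foldl (toppleStep I) s := by
  induction α generalizing s with
  | nil => exact (hs y hy).elim
  | cons z r ih =>
    by_cases hzy : z = y
    · subst hzy
      simpa using hα.2
    · have hcomm := toppleStep_comm I hzy hα.1 hy
      obtain ⟨hmem, hlegal, hfold⟩ :=
        ih hα.2 hs (isActive_applyInstr (I z (s.2 z)) (Ne.symm hzy) hy)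
      rw [hcomm] at hlegal hfold
      rw [List.erase_cons_tail (by simpa using hzy)]
      exact ⟨List.mem_cons_of_mem _ hmem, ⟨isActive_applyInstr _ hzy hα.1, hlegal⟩, hfold⟩

theorem LegalFrom.count_le {V : Type} [AddGroup V] [One V] [DecidableEq V] {I : V → ℕ → Instr}
    {α α' : List V} {s : (V → SiteState) × (V → ℕ)} (hα' : LegalFrom I s α')
    (hα : LegalFrom I s α) (hs : IsStable (α.foldl (toppleStep I) s).1) (x : V) :
    α'.count x ≤ α.count x := by
  induction α' generalizing s α with
  | nil => simp
  | cons y r ih =>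
    obtain ⟨hmem, hlegal, hfold⟩ := hα.erase hs hα'.1
    rw [(List.perm_cons_erase hmem).count_eq x, List.count_cons, List.count_cons]
    exact Nat.add_le_add_right (ih hα'.2 hlegal (hfold ▸ hs)) _

/-- **Least Action Principle (Lemma 1 of Rolla–Sidoravicius).**
For a fixed realization of the instruction stacks on `ℤ/nℤ` and a fixed initial
configuration `η`, if `α` is a legal toppling sequence stabilizing `η` and `α'` is any
legal toppling sequence for `η`, then `h_{α'}(x) ≤ h_α(x)` at every site `x`. -/
theorem least_action_principle (n : ℕ) (I : ZMod n → ℕ → Instr)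
    (hI : ∀ (x : ZMod n) (j : ℕ), I x j ≠ Instr.null)
    (η : ZMod n → SiteState) (α α' : List (ZMod n))
    (hα : Stabilizes I η α) (hα' : IsLegal I η α') :
    ∀ x : ZMod n, odometer α' x ≤ odometer α x := by
  exact hα'.count_le hα.1 hα.2

end ARW
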